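/- Let 0 < p < ∞ and let u be a real-valued harmonic function on the unit disk 𝔻. Then there is a constant C_p, depending only on p, such that |∇u(0)|^p ≤ C_p ∫_{(1/2)𝔻} |u|^p dA, where ∇u denotes the gradient of u and (1/2)𝔻 = {z : |z| < 1/2}. -/

import Mathlib

open MeasureTheory Metric Complex

/-- A Borel–Carathéodory type oscillation bound for the real part of a holomorphic function. -/
lemma abs_re_sub_re_le {H : ℂ → ℂ} {c z : ℂ} {R M : ℝ} (hR : 0 < R)
    (hH : DifferentiableOn ℂ H (ball c R)) (hM : ∀ w ∈ ball c R, |(H w).re| ≤ M)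
    (hz : ‖z - c‖ ≤ R / 2) :
    |(H z).re - (H c).re| ≤ 8 * M / R * ‖z - c‖ := by
  have hzR : z ∈ ball c R := by rw [mem_ball_iff_norm]; linarith
  have hc := hM c (mem_ball_self hR)
  obtain h0 | hMpos := ((abs_nonneg _).trans hc).eq_or_lt
  · have hz0 := abs_nonpos_iff.1 ((hM z hzR).trans h0.symm.le)
    have hc0 := abs_nonpos_iff.1 (hc.trans h0.symm.le)
    simp [hz0, hc0, ← h0]
  have maps : ∀ w ∈ ball (0 : ℂ) R, c + w ∈ ball c R := by
    intro w hw; simpa [mem_ball_iff_norm] using hw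
  have hd : DifferentiableOn ℂ (fun w => H (c + w) - H c) (ball 0 R) :=
    (hH.comp (by fun_prop) maps).sub_const _
  have key := borelCaratheodory_zero (M := 2 * M) (z := z - c) (by positivity) hd
    (by
      intro w hw
      have h1 := abs_le.1 (hM _ (maps w hw))
      have h2 := abs_le.1 hc
      simp only [Set.mem_ofPred_eq, sub_re]
      linarith) hR (by rw [mem_ball_zero_iff]; linarith) (by simp)
  simp only [add_sub_cancel] at key
  calc |(H z).re - (H c).re| = |(H z - H c).re| := by rw [sub_re]
    _ ≤ ‖H z - H c‖ := abs_re_le_norm _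
    _ ≤ 2 * (2 * M) * ‖z - c‖ / (R - ‖z - c‖) := key
    _ ≤ 2 * (2 * M) * ‖z - c‖ / (R / 2) := by gcongr; linarith
    _ = 8 * M / R * ‖z - c‖ := by field_simp; ring

/-- Weighted pointwise bound: `|Re H|^p` times the squared distance to the circle `|z| = 1/2` is
controlled by the `L^p` integral of `Re H` over the half disk, for every `p > 0`. -/
lemma exists_rpow_abs_re_mul_sq_le (p : ℝ) (hp : 0 < p) :
    ∃ C : ℝ, 0 < C ∧ ∀ H : ℂ → ℂ, DifferentiableOn ℂ H (ball 0 1) →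
      ∀ z ∈ ball (0 : ℂ) (1 / 2), |(H z).re| ^ p * (1 / 2 - ‖z‖) ^ 2 ≤
        C * ∫ w in ball (0 : ℂ) (1 / 2), |(H w).re| ^ p := by
  set K : ℝ := 4 ^ (1 / p) with hK
  have hK1 : 1 ≤ K := Real.one_le_rpow (by norm_num) (by positivity)
  have hK0 : 0 < K := by linarith
  have hKp : K ^ p = 4 := by
    rw [hK, ← Real.rpow_mul (by norm_num), one_div_mul_cancel hp.ne', Real.rpow_one]
  refine ⟨2 ^ p * (32 * K) ^ 2 / Real.pi, by positivity, fun H hH z hz => ?_⟩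
  have hsub : closedBall (0 : ℂ) (1 / 2) ⊆ ball 0 1 := closedBall_subset_ball (by norm_num)
  have hcont : ContinuousOn (fun w => |(H w).re| ^ p) (closedBall (0 : ℂ) (1 / 2)) :=
    ((continuous_re.comp_continuousOn (hH.continuousOn.mono hsub)).abs).rpow_const
      (fun _ _ => Or.inr hp.le)
  have hint : IntegrableOn (fun w => |(H w).re| ^ p) (ball (0 : ℂ) (1 / 2)) :=
    (hcont.integrableOn_compact (isCompact_closedBall _ _)).mono_set ball_subset_closedBall
  have hI : 0 ≤ ∫ w in ball (0 : ℂ) (1 / 2), |(H w).re| ^ p :=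
    integral_nonneg fun _ => by positivity
  obtain ⟨a, ha, hmax⟩ := (isCompact_closedBall (0 : ℂ) (1 / 2)).exists_isMaxOn
    (f := fun w => |(H w).re| ^ p * (1 / 2 - ‖w‖) ^ 2) ⟨z, ball_subset_closedBall hz⟩
    (hcont.mul (by fun_prop))
  have hmax' : ∀ w ∈ closedBall (0 : ℂ) (1 / 2), |(H w).re| ^ p * (1 / 2 - ‖w‖) ^ 2 ≤
      |(H a).re| ^ p * (1 / 2 - ‖a‖) ^ 2 := fun w hw => hmax hw
  refine (hmax' z (ball_subset_closedBall hz)).trans ?_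
  set A := |(H a).re| with hA
  set d := 1 / 2 - ‖a‖ with hd
  have hA0 : 0 ≤ A := abs_nonneg _
  have hd0 : 0 ≤ d := by rw [mem_closedBall_zero_iff] at ha; linarith
  obtain h0 | hdpos := hd0.eq_or_lt
  · rw [← h0]
    simp only [ne_eq, OfNat.ofNat_ne_zero, not_false_eq_true, zero_pow, mul_zero]
    positivity
  have hnear : ∀ w ∈ ball a (d / 2), d / 2 ≤ 1 / 2 - ‖w‖ := by
    intro w hw
    rw [mem_ball_iff_norm] at hw
    have := norm_sub_norm_le w a
    linarith
  have hhalf : ∀ w ∈ ball a (d / 2), w ∈ ball (0 : ℂ) (1 / 2) := by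
    intro w hw
    have := hnear w hw
    rw [mem_ball_zero_iff]
    linarith
  have hbd : ∀ w ∈ ball a (d / 2), |(H w).re| ≤ K * A := by
    intro w hw
    have h1 := hmax' w (ball_subset_closedBall (hhalf w hw))
    have h2 : |(H w).re| ^ p * (d / 2) ^ 2 ≤ A ^ p * d ^ 2 := by
      refine le_trans ?_ h1
      gcongr
      exact hnear w hw
    rw [← Real.rpow_le_rpow_iff (abs_nonneg _) (by positivity) hp,
      Real.mul_rpow hK0.le hA0, hKp]
    have h3 : 0 < d ^ 2 := by positivity
    nlinarith
  set r := d / (32 * K) with hr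
  have hr0 : 0 < r := by positivity
  have hr4 : r ≤ d / 2 / 2 := by
    rw [hr, div_div]
    exact div_le_div_of_nonneg_left hd0 (by norm_num) (by linarith)
  have hlow : ∀ w ∈ ball a r, (A / 2) ^ p ≤ |(H w).re| ^ p := by
    intro w hw
    rw [mem_ball_iff_norm] at hw
    have h1 := abs_re_sub_re_le (half_pos hdpos)
      (hH.mono fun w hw => hsub (ball_subset_closedBall (hhalf w hw))) hbd (hw.le.trans hr4)
    have h2 : 8 * (K * A) / (d / 2) * ‖w - a‖ ≤ 8 * (K * A) / (d / 2) * r := by gcongr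
    have h3 : 8 * (K * A) / (d / 2) * r = A / 2 := by
      rw [hr]; field_simp; ring
    have h4 : A - |(H w).re| ≤ |(H w).re - (H a).re| := by
      rw [abs_sub_comm]; exact abs_sub_abs_le_abs_sub _ _
    gcongr
    linarith
  have hball : ball a r ⊆ ball (0 : ℂ) (1 / 2) := fun w hw =>
    hhalf w (ball_subset_ball (by linarith) hw)
  have hvol : volume.real (ball a r) = r ^ 2 * Real.pi := by
    simp [measureReal_def, Complex.volume_ball, hr0.le]
  have h5 := setIntegral_ge_of_const_le_real measurableSet_ball measure_ball_lt_top.ne hlow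
    (hint.mono_set hball)
  have h6 := h5.trans (setIntegral_mono_set hint (.of_forall fun _ => by positivity)
    hball.eventuallyLE)
  rw [hvol, Real.div_rpow hA0 (by norm_num)] at h6
  calc A ^ p * d ^ 2 = 2 ^ p * (32 * K) ^ 2 / Real.pi *
        (A ^ p / 2 ^ p * (r ^ 2 * Real.pi)) := by rw [hr]; field_simp
    _ ≤ _ := by gcongr

/-- **Gradient estimate.** If `0 < p < ∞` and `u` is real-valued harmonic on `𝔻`
(equivalently, `u = Re H` on `𝔻` for some holomorphic `H`, since `𝔻` is simply
connected), then `|∇u(0)|^p ≤ C_p ∫_{(1/2)𝔻} |u|^p dA` with `C_p` depending only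
on `p`. -/
theorem gradient_bound_harmonic (p : ℝ) (hp : 0 < p) :
    ∃ C : ℝ, 0 < C ∧ ∀ u : ℂ → ℝ,
      (∃ H : ℂ → ℂ, DifferentiableOn ℂ H (ball 0 1) ∧
        ∀ z ∈ ball (0 : ℂ) 1, u z = (H z).re) →
      ‖fderiv ℝ u 0‖ ^ p ≤ C * ∫ z in ball (0 : ℂ) (1 / 2), |u z| ^ p := by
  obtain ⟨C, hC, hbound⟩ := exists_rpow_abs_re_mul_sq_le p hp
  refine ⟨32 ^ p * (16 * C), by positivity, ?_⟩
  rintro u ⟨H, hH, hu⟩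
  have hIeq : ∫ z in ball (0 : ℂ) (1 / 2), |u z| ^ p =
      ∫ z in ball (0 : ℂ) (1 / 2), |(H z).re| ^ p :=
    setIntegral_congr_fun measurableSet_ball fun z hz => by
      simp only [hu z (ball_subset_ball (by norm_num) hz)]
  rw [hIeq]
  set I := ∫ z in ball (0 : ℂ) (1 / 2), |(H z).re| ^ p
  have hI : 0 ≤ I := integral_nonneg fun _ => by positivity
  set M : ℝ := (16 * C * I) ^ (1 / p) with hM
  have hM0 : 0 ≤ M := by positivity
  have hMp : M ^ p = 16 * C * I := by
    rw [hM, ← Real.rpow_mul (by positivity), one_div_mul_cancel hp.ne', Real.rpow_one]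
  have hle : ∀ w ∈ ball (0 : ℂ) (1 / 4), |(H w).re| ≤ M := by
    intro w hw
    have h1 := hbound H hH w (ball_subset_ball (by norm_num) hw)
    rw [mem_ball_zero_iff] at hw
    rw [← Real.rpow_le_rpow_iff (abs_nonneg _) hM0 hp, hMp]
    have h2 : |(H w).re| ^ p * (1 / 4) ^ 2 ≤ |(H w).re| ^ p * (1 / 2 - ‖w‖) ^ 2 := by
      gcongr
      linarith
    linarith
  have hgrad : ‖fderiv ℝ u 0‖ ≤ 32 * M := by
    refine norm_fderiv_le_of_lip' ℝ (by positivity) ?_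
    filter_upwards [ball_mem_nhds (0 : ℂ) (show (0 : ℝ) < 1 / 8 by norm_num)] with w hw
    rw [hu w (ball_subset_ball (by norm_num) hw), hu 0 (mem_ball_self one_pos), Real.norm_eq_abs]
    rw [mem_ball_iff_norm] at hw
    have h := abs_re_sub_re_le (by norm_num) (hH.mono (ball_subset_ball (by norm_num))) hle
      (z := w) (by linarith)
    convert h using 2
    ring
  calc ‖fderiv ℝ u 0‖ ^ p ≤ (32 * M) ^ p := by gcongr
    _ = 32 ^ p * (16 * C) * I := by
      rw [Real.mul_rpow (by norm_num) hM0, hMp]; ring
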